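/- Let E, F, G be real Banach spaces, P : E → F and Q : E → G arbitrary functions, and C ≥ 0 a constant such that ‖∑_{i=1}^k λᵢ Q(xᵢ)‖ ≤ C·‖∑_{i=1}^k λᵢ P(xᵢ)‖ for all k ∈ ℕ, all x₁, …, x_k ∈ E and all scalars λ₁, …, λ_k ∈ ℝ. Then there exists a bounded linear operator W̃ : F → ℓ∞(B_{G*}) such that W̃(P(x)) = I_G(Q(x)) for every x ∈ E and ‖W̃‖ ≤ C, where I_G : G → ℓ∞(B_{G*}) is the canonical metric injection I_G(y) = (φ(y))_{φ ∈ B_{G*}}. -/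

import Mathlib

open scoped ENNReal

/-- The canonical metric injection `I_G : G → ℓ∞(B_{G*})`, `I_G y = (φ y)_{φ ∈ B_{G*}}`. -/
noncomputable def canonicalInj (G : Type*) [NormedAddCommGroup G] [NormedSpace ℝ G] :
    G → lp (fun _ : (Metric.closedBall (0 : G →L[ℝ] ℝ) 1) => ℝ) ∞ := fun y =>
  ⟨fun φ => (φ : G →L[ℝ] ℝ) y, memℓp_infty ⟨‖y‖, by
    rintro r ⟨φ, rfl⟩
    calc ‖(φ : G →L[ℝ] ℝ) y‖ ≤ ‖(φ : G →L[ℝ] ℝ)‖ * ‖y‖ := (φ : G →L[ℝ] ℝ).le_opNorm y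
      _ ≤ 1 * ‖y‖ := by
          have hφ : ‖(φ : G →L[ℝ] ℝ)‖ ≤ 1 := mem_closedBall_zero_iff.mp φ.2
          exact mul_le_mul_of_nonneg_right hφ (norm_nonneg y)
      _ = ‖y‖ := one_mul _⟩⟩

/-- A functional on a vector space dominated by the norm of a linear map `p` factors through `p`
via a continuous functional with the same bound. -/
theorem exists_strongDual_comp_eq_of_abs_le {V F : Type*} [AddCommGroup V] [Module ℝ V]
    [NormedAddCommGroup F] [NormedSpace ℝ F] (p : V →ₗ[ℝ] F) (q : V →ₗ[ℝ] ℝ) {C : ℝ} (hC : 0 ≤ C)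
    (h : ∀ v, |q v| ≤ C * ‖p v‖) :
    ∃ g : F →L[ℝ] ℝ, (∀ v, g (p v) = q v) ∧ ‖g‖ ≤ C := by
  have hker : LinearMap.ker p ≤ LinearMap.ker q := fun v hv => by
    have hv' : p v = 0 := hv
    simpa [hv'] using h v
  let f : LinearMap.range p →ₗ[ℝ] ℝ :=
    (LinearMap.ker p).liftQ q hker ∘ₗ p.quotKerEquivRange.symm.toLinearMap
  have hf : ∀ v, f ⟨p v, v, rfl⟩ = q v := fun v => by
    have hv : p.quotKerEquivRange.symm ⟨p v, v, rfl⟩ = (LinearMap.ker p).mkQ v :=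
      p.quotKerEquivRange_symm_apply_image v _
    simp [f, hv]
  have hbound : ∀ y, ‖f y‖ ≤ C * ‖y‖ := by
    rintro ⟨_, v, rfl⟩
    rw [hf]
    exact h v
  obtain ⟨g, hg, hnorm⟩ := exists_extension_norm_eq (LinearMap.range p) (f.mkContinuous C hbound)
  exact ⟨g, fun v => (hg ⟨p v, v, rfl⟩).trans (hf v),
    hnorm.trans_le (f.mkContinuous_norm_le hC hbound)⟩

/-- A family of functionals of norm at most `C` assembles into an operator into `ℓ∞` of norm
at most `C`. -/
theorem exists_clm_lp_infty_of_norm_le {ι F : Type*} [NormedAddCommGroup F] [NormedSpace ℝ F]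
    (g : ι → F →L[ℝ] ℝ) {C : ℝ} (hC : 0 ≤ C) (hg : ∀ i, ‖g i‖ ≤ C) :
    ∃ W : F →L[ℝ] lp (fun _ : ι => ℝ) ∞, (∀ y i, W y i = g i y) ∧ ‖W‖ ≤ C := by
  have hbound : ∀ y i, ‖g i y‖ ≤ C * ‖y‖ := fun y i => (g i).le_of_opNorm_le (hg i) y
  let W : F →ₗ[ℝ] lp (fun _ : ι => ℝ) ∞ :=
    { toFun y := ⟨fun i => g i y, memℓp_infty ⟨C * ‖y‖, by rintro _ ⟨i, rfl⟩; exact hbound y i⟩⟩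
      map_add' y z := by ext i; exact map_add (g i) y z
      map_smul' c y := by ext i; exact map_smul (g i) c y }
  have hW : ∀ y, ‖W y‖ ≤ C * ‖y‖ := fun y =>
    lp.norm_le_of_forall_le (mul_nonneg hC (norm_nonneg y)) (hbound y)
  exact ⟨W.mkContinuous C hW, fun _ _ => rfl, W.mkContinuous_norm_le hC hW⟩

/-- An inequality between norms of finite sums indexed by `Fin k` passes to
`Finsupp.linearCombination`. -/
theorem norm_linearCombination_le_of_fin {E F G : Type*} [NormedAddCommGroup F] [NormedSpace ℝ F]
    [NormedAddCommGroup G] [NormedSpace ℝ G] {P : E → F} {Q : E → G} {C : ℝ}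
    (h : ∀ (k : ℕ) (x : Fin k → E) (lam : Fin k → ℝ),
      ‖∑ i, lam i • Q (x i)‖ ≤ C * ‖∑ i, lam i • P (x i)‖) (v : E →₀ ℝ) :
    ‖Finsupp.linearCombination ℝ Q v‖ ≤ C * ‖Finsupp.linearCombination ℝ P v‖ := by
  let e := v.support.equivFin.symm
  have key := h _ (fun i => (e i : E)) (fun i => v (e i))
  rwa [e.sum_comp (fun a => v a • Q a), e.sum_comp (fun a => v a • P a),
    Finset.sum_coe_sort v.support (fun a => v a • Q a),
    Finset.sum_coe_sort v.support (fun a => v a • P a)] at key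

/-- If `‖∑ λᵢ • Q xᵢ‖ ≤ C * ‖∑ λᵢ • P xᵢ‖` for all finite families, then there is a
bounded linear operator `W̃ : F → ℓ∞(B_{G*})` with `W̃ (P x) = I_G (Q x)` and `‖W̃‖ ≤ C`. -/
theorem stmt5 (E F G : Type*) [NormedAddCommGroup E] [NormedSpace ℝ E] [CompleteSpace E]
    [NormedAddCommGroup F] [NormedSpace ℝ F] [CompleteSpace F]
    [NormedAddCommGroup G] [NormedSpace ℝ G] [CompleteSpace G]
    (P : E → F) (Q : E → G) (C : ℝ) (hC : 0 ≤ C)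
    (h : ∀ (k : ℕ) (x : Fin k → E) (lam : Fin k → ℝ),
      ‖∑ i, lam i • Q (x i)‖ ≤ C * ‖∑ i, lam i • P (x i)‖) :
    ∃ W : F →L[ℝ] lp (fun _ : (Metric.closedBall (0 : G →L[ℝ] ℝ) 1) => ℝ) ∞,
      (∀ x : E, W (P x) = canonicalInj G (Q x)) ∧ ‖W‖ ≤ C := by
  have hfactor (φ : Metric.closedBall (0 : G →L[ℝ] ℝ) 1) :
      ∃ g : F →L[ℝ] ℝ, (∀ x, g (P x) = (φ : G →L[ℝ] ℝ) (Q x)) ∧ ‖g‖ ≤ C := by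
    have hφ : ‖(φ : G →L[ℝ] ℝ)‖ ≤ 1 := mem_closedBall_zero_iff.mp φ.2
    obtain ⟨g, hg, hgC⟩ := exists_strongDual_comp_eq_of_abs_le (Finsupp.linearCombination ℝ P)
      ((φ : G →L[ℝ] ℝ).toLinearMap ∘ₗ Finsupp.linearCombination ℝ Q) hC fun v =>
        ((φ : G →L[ℝ] ℝ).le_of_opNorm_le hφ _).trans
          ((one_mul _).trans_le (norm_linearCombination_le_of_fin h v))
    exact ⟨g, fun x => by simpa using hg (Finsupp.single x 1), hgC⟩
  choose g hg hgC using hfactor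
  obtain ⟨W, hW, hWC⟩ := exists_clm_lp_infty_of_norm_le g hC hgC
  refine ⟨W, fun x => ?_, hWC⟩
  ext φ
  exact (hW (P x) φ).trans (hg φ x)
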